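/- Let n ≥ 2, let F ⊆ ℝⁿ be a Lebesgue measurable set with finite measure and finite perimeter, let α₀ ∈ ℝ, and set H := {x ∈ ℝⁿ : x·eₙ ≥ α₀} where eₙ = (0,…,0,1). If Lⁿ(F ∩ {x : x·eₙ < α₀}) > 0, then Per(F ∩ H) < Per(F). -/

import Mathlib

open MeasureTheory
open scoped ENNReal

/-- The divergence of a vector field on `ℝⁿ`. -/
noncomputable def vecDiv {n : ℕ} (φ : EuclideanSpace ℝ (Fin n) → EuclideanSpace ℝ (Fin n))
    (x : EuclideanSpace ℝ (Fin n)) : ℝ :=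
  ∑ i : Fin n, fderiv ℝ φ x (EuclideanSpace.single i 1) i

/-- The perimeter of a set `E` relative to an open set `F`:
`Per(E;F) = sup { ∫_E div φ dx : φ ∈ C¹_0(F, ℝⁿ), |φ| ≤ 1 }`. -/
noncomputable def perIn {n : ℕ} (E F : Set (EuclideanSpace ℝ (Fin n))) : ℝ≥0∞ :=
  ⨆ φ : {φ : EuclideanSpace ℝ (Fin n) → EuclideanSpace ℝ (Fin n) //
      ContDiff ℝ 1 φ ∧ HasCompactSupport φ ∧ tsupport φ ⊆ F ∧ ∀ x, ‖φ x‖ ≤ 1},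
    ENNReal.ofReal (∫ x in E, vecDiv φ.1 x)

/-- The perimeter of `E` (relative to all of `ℝⁿ`). -/
noncomputable def per {n : ℕ} (E : Set (EuclideanSpace ℝ (Fin n))) : ℝ≥0∞ :=
  perIn E Set.univ

open Filter Topology

section VectorFields

variable {n : ℕ}

lemma vecDiv_smul {f : EuclideanSpace ℝ (Fin n) → ℝ}
    {φ : EuclideanSpace ℝ (Fin n) → EuclideanSpace ℝ (Fin n)} {x : EuclideanSpace ℝ (Fin n)}
    (hf : DifferentiableAt ℝ f x) (hφ : DifferentiableAt ℝ φ x) :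
    vecDiv (fun y => f y • φ y) x = f x * vecDiv φ x + fderiv ℝ f x (φ x) := by
  have hsum : φ x = ∑ i, φ x i • EuclideanSpace.single i (1 : ℝ) := by
    ext k
    simp [Finset.sum_apply, Pi.single_apply]
  conv_rhs => rw [hsum]
  simp only [vecDiv, fderiv_fun_smul hf hφ, map_sum, map_smul, Finset.mul_sum,
    ← Finset.sum_add_distrib]
  refine Finset.sum_congr rfl fun i _ => ?_
  simp [mul_comm]

lemma vecDiv_add {φ ψ : EuclideanSpace ℝ (Fin n) → EuclideanSpace ℝ (Fin n)}
    {x : EuclideanSpace ℝ (Fin n)}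
    (hφ : DifferentiableAt ℝ φ x) (hψ : DifferentiableAt ℝ ψ x) :
    vecDiv (fun y => φ y + ψ y) x = vecDiv φ x + vecDiv ψ x := by
  simp [vecDiv, fderiv_fun_add hφ hψ, Finset.sum_add_distrib]

lemma vecDiv_smul_const {f : EuclideanSpace ℝ (Fin n) → ℝ} {x : EuclideanSpace ℝ (Fin n)}
    (hf : DifferentiableAt ℝ f x) (v : EuclideanSpace ℝ (Fin n)) :
    vecDiv (fun y => f y • v) x = fderiv ℝ f x v := by
  rw [vecDiv_smul hf (differentiableAt_const v)]
  simp [vecDiv]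

lemma continuous_vecDiv {φ : EuclideanSpace ℝ (Fin n) → EuclideanSpace ℝ (Fin n)}
    (hφ : ContDiff ℝ 1 φ) : Continuous (vecDiv φ) := by
  have h := hφ.continuous_fderiv one_ne_zero
  unfold vecDiv
  fun_prop

lemma integrable_vecDiv {φ : EuclideanSpace ℝ (Fin n) → EuclideanSpace ℝ (Fin n)}
    (hφ : ContDiff ℝ 1 φ) (hφc : HasCompactSupport φ) : Integrable (vecDiv φ) :=
  (continuous_vecDiv hφ).integrable_of_hasCompactSupport <|
    (hφc.fderiv ℝ).mono fun x hx h0 => hx (by simp [vecDiv, h0])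

/-- A `C¹` field bounded by one need not have compact support to be a competitor for the
perimeter of a set of finite measure, as soon as its divergence is integrable there. -/
lemma ofReal_integral_vecDiv_le_per {F : Set (EuclideanSpace ℝ (Fin n))}
    (hFvol : volume F < ⊤) {ψ : EuclideanSpace ℝ (Fin n) → EuclideanSpace ℝ (Fin n)}
    (hψ : ContDiff ℝ 1 ψ) (hψ1 : ∀ x, ‖ψ x‖ ≤ 1) (hint : IntegrableOn (vecDiv ψ) F) :
    ENNReal.ofReal (∫ x in F, vecDiv ψ x) ≤ per F := by
  let η : ContDiffBump (0 : EuclideanSpace ℝ (Fin n)) := ⟨1, 2, one_pos, one_lt_two⟩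
  have hη : ContDiff ℝ 1 η := η.contDiff
  obtain ⟨C, hC⟩ := (hη.continuous_fderiv one_ne_zero).bounded_above_of_compact_support
    (η.hasCompactSupport.fderiv ℝ)
  let r : ℕ → ℝ := fun k => 1 / ((k : ℝ) + 1)
  have hr0 : ∀ k, 0 < r k := fun k => by positivity
  have hr1 : ∀ k, r k ≤ 1 := fun k => by
    have : (0 : ℝ) ≤ k := k.cast_nonneg
    exact (div_le_one (by positivity)).2 (by linarith)
  have hrlim : Tendsto r atTop (𝓝 0) := tendsto_one_div_add_atTop_nhds_zero_nat
  let H : ℕ → EuclideanSpace ℝ (Fin n) → ℝ := fun k x => η (r k • x)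
  have hH : ∀ k, ContDiff ℝ 1 (H k) := fun k => hη.comp (contDiff_const_smul (r k))
  have hHd : ∀ k x, fderiv ℝ (H k) x = r k • fderiv ℝ η (r k • x) := fun k x => by
    simpa [H] using fderiv_comp_smul (𝕜 := ℝ) (f := η) (x := x) (r k)
  have hHs : ∀ k, HasCompactSupport (H k) := fun k =>
    η.hasCompactSupport.comp_smul (hr0 k).ne'
  have hdiv : ∀ k x, vecDiv (fun y => H k y • ψ y) x
      = η (r k • x) * vecDiv ψ x + r k * fderiv ℝ η (r k • x) (ψ x) := fun k x => by
    rw [vecDiv_smul ((hH k).differentiable one_ne_zero x) (hψ.differentiable one_ne_zero x), hHd]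
    rfl
  have hle : ∀ k, ENNReal.ofReal (∫ x in F, vecDiv (fun y => H k y • ψ y) x) ≤ per F := by
    intro k
    refine le_iSup_of_le ⟨fun y => H k y • ψ y, (hH k).smul hψ, (hHs k).smul_right,
      Set.subset_univ _, fun x => ?_⟩ le_rfl
    rw [norm_smul, Real.norm_of_nonneg η.nonneg]
    exact mul_le_one₀ η.le_one (norm_nonneg _) (hψ1 x)
  have hbd : ∀ k x, ‖r k * fderiv ℝ η (r k • x) (ψ x)‖ ≤ r k * C := fun k x => by
    rw [norm_mul, Real.norm_of_nonneg (hr0 k).le]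
    refine mul_le_mul_of_nonneg_left ?_ (hr0 k).le
    calc _ ≤ ‖fderiv ℝ η (r k • x)‖ * ‖ψ x‖ := ContinuousLinearMap.le_opNorm _ _
      _ ≤ ‖fderiv ℝ η (r k • x)‖ * 1 := by gcongr; exact hψ1 x
      _ ≤ C := by rw [mul_one]; exact hC _
  have hC0 : 0 ≤ C := (norm_nonneg _).trans (hC 0)
  have hlim : Tendsto (fun k => ∫ x in F, vecDiv (fun y => H k y • ψ y) x) atTop
      (𝓝 (∫ x in F, vecDiv ψ x)) := by
    refine tendsto_integral_of_dominated_convergence (fun x => ‖vecDiv ψ x‖ + C)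
      (fun k => (continuous_vecDiv ((hH k).smul hψ)).aestronglyMeasurable)
      (hint.norm.add (integrableOn_const hFvol.ne)) (fun k => ae_of_all _ fun x => ?_)
      (ae_of_all _ fun x => ?_)
    · rw [hdiv]
      refine (norm_add_le _ _).trans (add_le_add ?_ ((hbd k x).trans ?_))
      · rw [norm_mul, Real.norm_of_nonneg η.nonneg]
        exact mul_le_of_le_one_left (norm_nonneg _) η.le_one
      · exact mul_le_of_le_one_left hC0 (hr1 k)
    · simp only [hdiv]
      have h1 : Tendsto (fun k => η (r k • x)) atTop (𝓝 1) := by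
        have : Tendsto (fun k => r k • x) atTop (𝓝 0) := by
          simpa using hrlim.smul_const x
        have h2 := (hη.continuous.tendsto 0).comp this
        rwa [η.one_of_mem_closedBall (Metric.mem_closedBall_self zero_le_one)] at h2
      have h3 : Tendsto (fun k => r k * fderiv ℝ η (r k • x) (ψ x)) atTop (𝓝 0) :=
        squeeze_zero_norm (fun k => hbd k x) (by simpa using hrlim.mul_const C)
      simpa using (h1.mul_const (vecDiv ψ x)).add h3
  exact le_of_tendsto ((ENNReal.continuous_ofReal.tendsto _).comp hlim) (Eventually.of_forall hle)

lemma deriv_smoothTransition_of_neg {t : ℝ} (h : t < 0) : deriv Real.smoothTransition t = 0 := by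
  have : Real.smoothTransition =ᶠ[𝓝 t] fun _ => 0 :=
    (eventually_lt_nhds h).mono fun s hs => Real.smoothTransition.zero_of_nonpos hs.le
  simpa using this.deriv_eq

lemma exists_bound_deriv_smoothTransition :
    ∃ C, 0 ≤ C ∧ ∀ t, |deriv Real.smoothTransition t| ≤ C := by
  have hc : Continuous (deriv Real.smoothTransition) :=
    (Real.smoothTransition.contDiff (n := 1)).continuous_deriv le_rfl
  have hs : HasCompactSupport (deriv Real.smoothTransition) := by
    refine HasCompactSupport.of_support_subset_isCompact (isCompact_Icc (a := (0 : ℝ)) (b := 1)) ?_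
    intro t ht
    by_contra hmem
    refine ht ?_
    rcases lt_or_ge t 0 with h | h
    · exact deriv_smoothTransition_of_neg h
    · have h1 : 1 < t := by
        by_contra h1
        exact hmem ⟨h, not_lt.1 h1⟩
      have : Real.smoothTransition =ᶠ[𝓝 t] fun _ => 1 :=
        (eventually_gt_nhds h1).mono fun s hs => Real.smoothTransition.one_of_one_le (le_of_lt hs)
      simpa using this.deriv_eq
  obtain ⟨C, hC⟩ := hc.bounded_above_of_compact_support hs
  exact ⟨C, (norm_nonneg _).trans (hC 0), hC⟩

lemma ae_apply_ne (j : Fin n) (c : ℝ) : ∀ᵐ x : EuclideanSpace ℝ (Fin n), x j ≠ c :=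
  (PiLp.volume_preserving_ofLp (Fin n)).quasiMeasurePreserving.ae
    (Measure.ae_eval_ne (μ := fun _ => volume) j c)

lemma differentiable_smoothTransition : Differentiable ℝ Real.smoothTransition :=
  (Real.smoothTransition.contDiff (n := 1)).differentiable one_ne_zero

lemma continuous_deriv_smoothTransition : Continuous (deriv Real.smoothTransition) :=
  (Real.smoothTransition.contDiff (n := 1)).continuous_deriv le_rfl

lemma EuclideanSpace.hasFDerivAt_apply (j : Fin n) (x : EuclideanSpace ℝ (Fin n)) :
    HasFDerivAt (fun y : EuclideanSpace ℝ (Fin n) => y j)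
      (EuclideanSpace.proj j : EuclideanSpace ℝ (Fin n) →L[ℝ] ℝ) x :=
  (EuclideanSpace.proj j : EuclideanSpace ℝ (Fin n) →L[ℝ] ℝ).hasFDerivAt

/-- A competitor `φ` above the hyperplane `x j = c` can be glued to a field `ψ` below it
without losing divergence, provided `ψ` points in direction `-e_j` above the hyperplane. -/
lemma ofReal_integral_vecDiv_glue_le_per {F : Set (EuclideanSpace ℝ (Fin n))}
    (hFvol : volume F < ⊤) (j : Fin n) (c : ℝ)
    {φ ψ : EuclideanSpace ℝ (Fin n) → EuclideanSpace ℝ (Fin n)}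
    (hφ : ContDiff ℝ 1 φ) (hφ1 : ∀ x, ‖φ x‖ ≤ 1) (hφint : IntegrableOn (vecDiv φ) F)
    (hψ : ContDiff ℝ 1 ψ) (hψ1 : ∀ x, ‖ψ x‖ ≤ 1) (hψint : IntegrableOn (vecDiv ψ) F)
    (hψj : ∀ x, c ≤ x j → ψ x j = -1) :
    ENNReal.ofReal ((∫ x in F ∩ {x | c ≤ x j}, vecDiv φ x)
      + ∫ x in F ∩ {x | x j < c}, vecDiv ψ x) ≤ per F := by
  obtain ⟨C, hC0, hC⟩ := exists_bound_deriv_smoothTransition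
  let T := Real.smoothTransition
  let χ : ℕ → EuclideanSpace ℝ (Fin n) → ℝ := fun k x => T (k * (x j - c))
  have hχ0 : ∀ k x, 0 ≤ χ k x := fun k x => Real.smoothTransition.nonneg _
  have hχ1 : ∀ k x, χ k x ≤ 1 := fun k x => Real.smoothTransition.le_one _
  have hχ : ∀ k, ContDiff ℝ 1 (χ k) := fun k => by
    refine (Real.smoothTransition.contDiff (n := 1)).comp ?_
    fun_prop
  have hχd : ∀ k x, HasFDerivAt (χ k) ((deriv T (k * (x j - c)) * k) •
      (EuclideanSpace.proj j : EuclideanSpace ℝ (Fin n) →L[ℝ] ℝ)) x := fun k x => by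
    have h := (differentiable_smoothTransition (k * (x j - c))).hasDerivAt.comp_hasFDerivAt x
      (((EuclideanSpace.hasFDerivAt_apply j x).sub_const c).const_mul (k : ℝ))
    rwa [smul_smul] at h
  have hχ' : ∀ k, ContDiff ℝ 1 (fun x => 1 - χ k x) := fun k => contDiff_const.sub (hχ k)
  let G : ℕ → EuclideanSpace ℝ (Fin n) → EuclideanSpace ℝ (Fin n) :=
    fun k x => χ k x • φ x + (1 - χ k x) • ψ x
  have hG : ∀ k, ContDiff ℝ 1 (G k) := fun k => ((hχ k).smul hφ).add ((hχ' k).smul hψ)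
  have hG1 : ∀ k x, ‖G k x‖ ≤ 1 := fun k x => by
    have := (convex_closedBall (0 : EuclideanSpace ℝ (Fin n)) 1)
      (mem_closedBall_zero_iff.2 (hφ1 x)) (mem_closedBall_zero_iff.2 (hψ1 x))
      (hχ0 k x) (sub_nonneg.2 (hχ1 k x)) (add_sub_cancel _ _)
    exact mem_closedBall_zero_iff.1 this
  let A : ℕ → EuclideanSpace ℝ (Fin n) → ℝ :=
    fun k x => χ k x * vecDiv φ x + (1 - χ k x) * vecDiv ψ x
  let B : ℕ → EuclideanSpace ℝ (Fin n) → ℝ :=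
    fun k x => deriv T (k * (x j - c)) * k * (φ x j - ψ x j)
  have hdiv : ∀ k x, vecDiv (G k) x = A k x + B k x := fun k x => by
    have d1 := (hφ.differentiable one_ne_zero) x
    have d2 := (hψ.differentiable one_ne_zero) x
    have d3 := ((hχ k).differentiable one_ne_zero) x
    have d4 := ((hχ' k).differentiable one_ne_zero) x
    have e := ((hχd k x).const_sub 1).fderiv
    simp only [G, A, B]
    rw [vecDiv_add (d3.fun_smul d1) (d4.fun_smul d2), vecDiv_smul d3 d1, vecDiv_smul d4 d2,
      (hχd k x).fderiv, e]
    simp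
    ring
  have hcoord : ∀ (v : EuclideanSpace ℝ (Fin n)), ‖v‖ ≤ 1 → |v j| ≤ 1 := fun v hv =>
    (PiLp.norm_apply_le v j).trans hv
  have hBnn : ∀ k x, 0 ≤ B k x := fun k x => by
    rcases lt_or_ge (k * (x j - c)) 0 with h | h
    · simp [B, T, deriv_smoothTransition_of_neg h]
    · rcases Nat.eq_zero_or_pos k with rfl | hk
      · simp [B]
      · have hk' : (0 : ℝ) < k := Nat.cast_pos.2 hk
        have hx : c ≤ x j := sub_nonneg.1 (nonneg_of_mul_nonneg_right h hk')
        have := (abs_le.1 (hcoord _ (hφ1 x))).1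
        refine mul_nonneg (mul_nonneg Real.smoothTransition.monotone.deriv_nonneg hk'.le) ?_
        rw [hψj x hx]
        linarith
  have hAc : ∀ k, Continuous (A k) := fun k =>
    ((hχ k).continuous.mul (continuous_vecDiv hφ)).add
      ((hχ' k).continuous.mul (continuous_vecDiv hψ))
  have hAb : ∀ k x, ‖A k x‖ ≤ ‖vecDiv φ x‖ + ‖vecDiv ψ x‖ := fun k x => by
    refine (norm_add_le _ _).trans (add_le_add ?_ ?_)
    · rw [norm_mul, Real.norm_of_nonneg (hχ0 k x)]
      exact mul_le_of_le_one_left (norm_nonneg _) (hχ1 k x)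
    · rw [norm_mul, Real.norm_of_nonneg (sub_nonneg.2 (hχ1 k x))]
      exact mul_le_of_le_one_left (norm_nonneg _) (sub_le_self _ (hχ0 k x))
  have hbound : IntegrableOn (fun x => ‖vecDiv φ x‖ + ‖vecDiv ψ x‖) F :=
    hφint.norm.add hψint.norm
  have hAi : ∀ k, IntegrableOn (A k) F := fun k =>
    hbound.mono' (hAc k).aestronglyMeasurable (ae_of_all _ (hAb k))
  have hBi : ∀ k, IntegrableOn (B k) F := fun k => by
    have hc : Continuous (B k) := by
      have h1 := continuous_deriv_smoothTransition
      have h2 := hφ.continuous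
      have h3 := hψ.continuous
      simp only [B, T]
      fun_prop
    refine Measure.integrableOn_of_bounded hFvol.ne hc.aestronglyMeasurable (M := C * k * 2)
      (ae_of_all _ fun x => ?_)
    simp only [B, norm_mul, Real.norm_eq_abs, Nat.abs_cast]
    have h1 := hcoord _ (hφ1 x)
    have h2 := hcoord _ (hψ1 x)
    have h3 : |φ x j - ψ x j| ≤ 2 := by linarith [abs_sub (φ x j) (ψ x j)]
    have h4 := hC (k * (x j - c))
    gcongr
  have hint : ∀ k, IntegrableOn (vecDiv (G k)) F := fun k => by
    have : vecDiv (G k) = fun x => A k x + B k x := funext (hdiv k)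
    rw [this]
    exact (hAi k).add (hBi k)
  have hle : ∀ k, ENNReal.ofReal (∫ x in F, A k x) ≤ per F := fun k =>
    (ENNReal.ofReal_le_ofReal (setIntegral_mono (hAi k) (hint k) fun x => by
      rw [hdiv]; exact le_add_of_nonneg_right (hBnn k x))).trans
      (ofReal_integral_vecDiv_le_per hFvol (hG k) (hG1 k) (hint k))
  have hmH : MeasurableSet {x : EuclideanSpace ℝ (Fin n) | c ≤ x j} :=
    measurableSet_le measurable_const (by fun_prop)
  have hmL : MeasurableSet {x : EuclideanSpace ℝ (Fin n) | x j < c} :=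
    measurableSet_lt (by fun_prop) measurable_const
  have hlim : Tendsto (fun k => ∫ x in F, A k x) atTop
      (𝓝 ((∫ x in F ∩ {x | c ≤ x j}, vecDiv φ x) + ∫ x in F ∩ {x | x j < c}, vecDiv ψ x)) := by
    rw [Set.inter_comm F, Set.inter_comm F, ← Measure.restrict_restrict hmH,
      ← Measure.restrict_restrict hmL, ← integral_indicator hmH, ← integral_indicator hmL,
      ← integral_add (hφint.indicator hmH) (hψint.indicator hmL)]
    refine tendsto_integral_of_dominated_convergence _
      (fun k => (hAc k).aestronglyMeasurable) hbound (fun k => ae_of_all _ (hAb k)) ?_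
    filter_upwards [ae_restrict_of_ae (ae_apply_ne j c)] with x hx
    rcases lt_or_gt_of_ne hx with h | h
    · refine tendsto_const_nhds.congr fun k => ?_
      have : χ k x = 0 := Real.smoothTransition.zero_of_nonpos
        (mul_nonpos_of_nonneg_of_nonpos k.cast_nonneg (sub_nonpos.2 h.le))
      simp [A, this, h, not_le.2 h]
    · refine tendsto_const_nhds.congr' ?_
      have ht : Tendsto (fun k : ℕ => (k : ℝ) * (x j - c)) atTop atTop :=
        tendsto_natCast_atTop_atTop.atTop_mul_const (sub_pos.2 h)
      filter_upwards [ht.eventually_ge_atTop 1] with k hk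
      have : χ k x = 1 := Real.smoothTransition.one_of_one_le hk
      simp [A, this, h.le, not_lt.2 h.le]
  exact le_of_tendsto ((ENNReal.continuous_ofReal.tendsto _).comp hlim) (Eventually.of_forall hle)

/-- A field equal to `-e_j` above the hyperplane `x j = c` which bends sideways below it and
has positive total divergence in the part of `F` below the hyperplane. -/
lemma exists_field_integral_vecDiv_pos {F : Set (EuclideanSpace ℝ (Fin n))}
    (hFvol : volume F < ⊤) {i j : Fin n} (hij : i ≠ j) (c : ℝ)
    (hbelow : 0 < volume (F ∩ {x : EuclideanSpace ℝ (Fin n) | x j < c})) :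
    ∃ ψ : EuclideanSpace ℝ (Fin n) → EuclideanSpace ℝ (Fin n), ContDiff ℝ 1 ψ ∧
      (∀ x, ‖ψ x‖ ≤ 1) ∧ IntegrableOn (vecDiv ψ) F ∧ (∀ x, c ≤ x j → ψ x j = -1) ∧
      0 < ∫ x in F ∩ {x | x j < c}, vecDiv ψ x := by
  obtain ⟨C, hC0, hC⟩ := exists_bound_deriv_smoothTransition
  let T := Real.smoothTransition
  let s : EuclideanSpace ℝ (Fin n) → ℝ := fun x => T (c - x j) * Real.arctan (x i)
  have hs : ContDiff ℝ 1 s := by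
    refine ((Real.smoothTransition.contDiff (n := 1)).comp (by fun_prop)).mul
      (Real.contDiff_arctan.comp (by fun_prop))
  have harc : ∀ t, |Real.arctan t| ≤ 2 := fun t => by
    rw [abs_le]
    constructor <;>
      linarith [Real.neg_pi_div_two_lt_arctan t, Real.arctan_lt_pi_div_two t, Real.pi_le_four]
  have hT0 : ∀ t, 0 ≤ T t := Real.smoothTransition.nonneg
  have hT1 : ∀ t, T t ≤ 1 := Real.smoothTransition.le_one
  have hTabs : ∀ t, |T t| ≤ 1 := fun t => by rw [abs_of_nonneg (hT0 t)]; exact hT1 t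
  have hsb : ∀ x, |s x| ≤ 2 := fun x => by
    rw [abs_mul]
    exact (mul_le_of_le_one_left (abs_nonneg _) (hTabs _)).trans (harc _)
  let P : Fin n → EuclideanSpace ℝ (Fin n) →L[ℝ] ℝ := fun k => EuclideanSpace.proj k
  have hsd : ∀ x, HasFDerivAt s (T (c - x j) • ((1 / (1 + x i ^ 2)) • P i)
      + Real.arctan (x i) • (deriv T (c - x j) • -P j)) x := fun x =>
    (HasDerivAt.comp_hasFDerivAt (h₂ := T) x
      (differentiable_smoothTransition (c - x j)).hasDerivAt ((EuclideanSpace.hasFDerivAt_apply j x).const_sub c)).mul (EuclideanSpace.hasFDerivAt_apply i x).arctan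
  let a : EuclideanSpace ℝ (Fin n) → ℝ := fun x => T (c - x j) * (1 / (1 + x i ^ 2))
  let b : EuclideanSpace ℝ (Fin n) → ℝ :=
    fun x => -2 * s x * (Real.arctan (x i) * deriv T (c - x j))
  let ψ : ℝ → EuclideanSpace ℝ (Fin n) → EuclideanSpace ℝ (Fin n) := fun ε x =>
    (ε ^ 2 * s x ^ 2 - 1) • EuclideanSpace.single j 1 + (ε * s x) • EuclideanSpace.single i 1
  have hdiv : ∀ ε x, vecDiv (ψ ε) x = ε * a x + ε ^ 2 * b x := fun ε x => by
    have h1 := (((hsd x).pow 2).const_mul (ε ^ 2)).sub_const 1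
    have h2 := (hsd x).const_mul ε
    simp only [ψ]
    rw [vecDiv_add (h1.differentiableAt.smul_const _) (h2.differentiableAt.smul_const _),
      vecDiv_smul_const h1.differentiableAt, vecDiv_smul_const h2.differentiableAt,
      h1.fderiv, h2.fderiv]
    simp [P, hij, hij.symm, a, b]
    ring
  have hac : Continuous a := by
    have h1 : Continuous T := Real.smoothTransition.continuous
    have h2 : ∀ x : EuclideanSpace ℝ (Fin n), 1 + x i ^ 2 ≠ 0 := fun x => by positivity
    simp only [a]
    fun_prop (disch := assumption)
  have hbc : Continuous b := by
    have h1 := continuous_deriv_smoothTransition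
    have h2 := hs.continuous
    have h3 := Real.continuous_arctan
    simp only [b, T]
    fun_prop
  have ha0 : ∀ x, 0 ≤ a x := fun x => mul_nonneg (hT0 _) (by positivity)
  have hai : IntegrableOn a F := by
    refine Measure.integrableOn_of_bounded hFvol.ne hac.aestronglyMeasurable (M := 1)
      (ae_of_all _ fun x => ?_)
    rw [Real.norm_of_nonneg (ha0 x)]
    refine mul_le_one₀ (hT1 _) (by positivity) ?_
    exact (div_le_one (by positivity)).2 (by nlinarith [sq_nonneg (x i)])
  have hbi : IntegrableOn b F := by
    refine Measure.integrableOn_of_bounded hFvol.ne hbc.aestronglyMeasurable (M := 2 * 2 * (2 * C))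
      (ae_of_all _ fun x => ?_)
    simp only [b, norm_mul, Real.norm_eq_abs, abs_neg, abs_two]
    have h1 := hsb x
    have h2 := harc (x i)
    have h3 := hC (c - x j)
    gcongr
  set L : Set (EuclideanSpace ℝ (Fin n)) := {x | x j < c}
  have hmL : MeasurableSet L := measurableSet_lt (by fun_prop) measurable_const
  have hI : 0 < ∫ x in F ∩ L, a x := by
    rw [setIntegral_pos_iff_support_of_nonneg_ae (ae_of_all _ ha0)
      (hai.mono_set Set.inter_subset_left)]
    refine hbelow.trans_le (measure_mono fun x hx => ⟨?_, hx⟩)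
    have : 0 < T (c - x j) := Real.smoothTransition.pos_of_pos (sub_pos.2 hx.2)
    exact (mul_pos this (by positivity)).ne'
  set I := ∫ x in F ∩ L, a x
  set J := ∫ x in F ∩ L, b x
  obtain ⟨ε, hε0, hε1, hεI⟩ : ∃ ε : ℝ, 0 < ε ∧ ε ≤ 1 / 2 ∧ 0 < ε * I + ε ^ 2 * J := by
    refine ⟨min (1 / 2) (I / (2 * (|J| + 1))), by positivity, min_le_left _ _, ?_⟩
    set ε := min (1 / 2) (I / (2 * (|J| + 1)))
    have hε0 : 0 < ε := by positivity
    have h1 : ε * (2 * (|J| + 1)) ≤ I := (le_div_iff₀ (by positivity)).1 (min_le_right _ _)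
    have h2 : 0 < I + ε * J := by
      nlinarith [neg_abs_le J, abs_nonneg J, mul_nonneg hε0.le (abs_nonneg J),
        mul_le_mul_of_nonneg_left (neg_abs_le J) hε0.le]
    nlinarith [mul_pos hε0 h2]
  refine ⟨ψ ε, ?_, fun x => ?_, ?_, fun x hx => ?_, ?_⟩
  · exact (((contDiff_const.mul (hs.pow 2)).sub contDiff_const).smul contDiff_const).add
      ((contDiff_const.mul hs).smul contDiff_const)
  · have hu : (ε * s x) ^ 2 ≤ 1 := by
      rw [sq_le_one_iff_abs_le_one, abs_mul, abs_of_pos hε0]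
      nlinarith [hsb x, abs_nonneg (s x)]
    have hn : ‖ψ ε x‖ ^ 2 = (ε ^ 2 * s x ^ 2 - 1) ^ 2 + (ε * s x) ^ 2 := by
      simp only [ψ]
      rw [norm_add_sq_real]
      have h0 : inner ℝ (EuclideanSpace.single j (1 : ℝ)) (EuclideanSpace.single i 1) = 0 := by
        simp [EuclideanSpace.inner_single_left, hij]
      simp [norm_smul, inner_smul_left, inner_smul_right, h0, mul_pow]
    refine (sq_le_one_iff₀ (norm_nonneg _)).1 ?_
    rw [hn]
    nlinarith [sq_nonneg (ε * s x)]
  · rw [show vecDiv (ψ ε) = fun x => ε * a x + ε ^ 2 * b x from funext (hdiv ε)]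
    exact (hai.const_mul _).add (hbi.const_mul _)
  · have : T (c - x j) = 0 := Real.smoothTransition.zero_of_nonpos (sub_nonpos.2 hx)
    simp [ψ, s, this]
  · have hai' : IntegrableOn a (F ∩ L) := hai.mono_set Set.inter_subset_left
    have hbi' : IntegrableOn b (F ∩ L) := hbi.mono_set Set.inter_subset_left
    simp only [hdiv]
    rw [integral_add (hai'.const_mul _) (hbi'.const_mul _), integral_const_mul,
      integral_const_mul]
    exact hεI

end VectorFields

/-- Cutting a set of finite measure and finite perimeter with the half space
`H = {x : x·eₙ ≥ α₀}` (where `eₙ` is the last coordinate vector) strictly decreases the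
perimeter, provided the part of the set below the hyperplane has positive measure. -/
theorem perimeter_strictly_decreases_halfspace_cut (n : ℕ) (hn : 2 ≤ n)
    (F : Set (EuclideanSpace ℝ (Fin n))) (hFmeas : MeasurableSet F)
    (hFvol : volume F < ⊤) (hFper : per F < ⊤) (α₀ : ℝ)
    (hbelow : 0 < volume (F ∩ {x : EuclideanSpace ℝ (Fin n) | x ⟨n - 1, by omega⟩ < α₀})) :
    per (F ∩ {x : EuclideanSpace ℝ (Fin n) | α₀ ≤ x ⟨n - 1, by omega⟩}) < per F := by
  obtain ⟨ψ, hψ, hψ1, hψint, hψj, hpos⟩ := exists_field_integral_vecDiv_pos hFvol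
    (i := ⟨0, by omega⟩) (j := ⟨n - 1, by omega⟩) (by simp [Fin.ext_iff]; omega) α₀ hbelow
  set δ := ∫ x in F ∩ {x : EuclideanSpace ℝ (Fin n) | x ⟨n - 1, by omega⟩ < α₀}, vecDiv ψ x
  have hglue : ∀ φ : EuclideanSpace ℝ (Fin n) → EuclideanSpace ℝ (Fin n), ContDiff ℝ 1 φ →
      HasCompactSupport φ → (∀ x, ‖φ x‖ ≤ 1) → ENNReal.ofReal
        ((∫ x in F ∩ {x : EuclideanSpace ℝ (Fin n) | α₀ ≤ x ⟨n - 1, by omega⟩}, vecDiv φ x) + δ)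
        ≤ per F := fun φ hφ hφc hφ1 =>
    ofReal_integral_vecDiv_glue_le_per hFvol ⟨n - 1, by omega⟩ α₀ hφ hφ1
      (integrable_vecDiv hφ hφc).integrableOn hψ hψ1 hψint hψj
  have hδ : ENNReal.ofReal δ ≤ per F := by
    simpa [vecDiv] using hglue (fun _ => 0) contDiff_const HasCompactSupport.zero (by simp)
  have key : per (F ∩ {x : EuclideanSpace ℝ (Fin n) | α₀ ≤ x ⟨n - 1, by omega⟩})
      + ENNReal.ofReal δ ≤ per F := by
    have : Nonempty {φ : EuclideanSpace ℝ (Fin n) → EuclideanSpace ℝ (Fin n) //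
        ContDiff ℝ 1 φ ∧ HasCompactSupport φ ∧ tsupport φ ⊆ Set.univ ∧ ∀ x, ‖φ x‖ ≤ 1} :=
      ⟨fun _ => 0, contDiff_const, HasCompactSupport.zero, Set.subset_univ _, by simp⟩
    rw [per, perIn, ENNReal.iSup_add]
    refine iSup_le fun ⟨φ, hφ, hφc, _, hφ1⟩ => ?_
    rcases le_total 0
      (∫ x in F ∩ {x : EuclideanSpace ℝ (Fin n) | α₀ ≤ x ⟨n - 1, by omega⟩}, vecDiv φ x)
      with h | h
    · rw [← ENNReal.ofReal_add h hpos.le]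
      exact hglue φ hφ hφc hφ1
    · rw [ENNReal.ofReal_of_nonpos h, zero_add]
      exact hδ
  have hfin : per (F ∩ {x : EuclideanSpace ℝ (Fin n) | α₀ ≤ x ⟨n - 1, by omega⟩}) ≠ ⊤ :=
    ((le_self_add.trans key).trans_lt hFper).ne
  exact (ENNReal.lt_add_right hfin (ENNReal.ofReal_pos.2 hpos).ne').trans_le key
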